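/- Under the hypotheses of the power-balance theorem (skew-adjointness conditions for (E, Q, J, K), S symmetric, N skew-symmetric, x a continuously differentiable solution of E ẋ = ((J−R)Q − EK)x + (B−P)u on I = [t0, tf] with output y = (B+P)ᵀQx + (S+N)u), assume additionally that the dissipation matrix W(t) = [[Q(t)ᵀR(t)Q(t), Q(t)ᵀP(t)], [P(t)ᵀQ(t), S(t)]] is positive semidefinite for every t ∈ I, meaning ⟪z, (QᵀRQ)⬝z⟫ + 2⟪z, (QᵀP)⬝w⟫ + ⟪w, S⬝w⟫ ≥ 0 for all z ∈ ℝⁿ, w ∈ ℝᵐ, t ∈ I. Then the dissipation inequality holds: for all t0 ≤ s ≤ t ≤ tf, (1/2)⟪x(t), (Q(t)ᵀ*E(t)) ⬝ x(t)⟫ − (1/2)⟪x(s), (Q(s)ᵀ*E(s)) ⬝ x(s)⟫ ≤ ∫_s^t ⟪u(τ), y(τ)⟫ dτ. -/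

import Mathlib

open Matrix Set

/-- `M'` is the entrywise derivative of the matrix-valued function `M` at `t`. -/
def MatHasDerivAt {α β : Type*} (M M' : ℝ → Matrix α β ℝ) (t : ℝ) : Prop :=
  ∀ i j, HasDerivAt (fun s => M s i j) (M' t i j) t

/-- The quadratic form of a differentiable matrix function along a differentiable curve satisfies
the product rule. -/
theorem MatHasDerivAt.hasDerivAt_dotProduct_mulVec {n : Type*} [Fintype n]
    {M M' : ℝ → Matrix n n ℝ} {x : ℝ → n → ℝ} {v : n → ℝ} {t : ℝ}
    (hM : MatHasDerivAt M M' t) (hx : HasDerivAt x v t) :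
    HasDerivAt (fun s => x s ⬝ᵥ M s *ᵥ x s)
      (v ⬝ᵥ M t *ᵥ x t + x t ⬝ᵥ (M' t *ᵥ x t + M t *ᵥ v)) t := by
  have hx' := hasDerivAt_pi.1 hx
  have h := HasDerivAt.fun_sum (u := Finset.univ) fun i _ =>
    (hx' i).fun_mul (HasDerivAt.fun_sum (u := Finset.univ) fun j _ => (hM i j).fun_mul (hx' j))
  refine h.congr_deriv ?_
  simp only [dotProduct, mulVec, Pi.add_apply, Finset.sum_add_distrib]

theorem dotProduct_mulVec_self_eq_zero {n : Type*} [Fintype n] {A : Matrix n n ℝ}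
    (hA : Aᵀ = -A) (v : n → ℝ) : v ⬝ᵥ A *ᵥ v = 0 := by
  have h := dotProduct_transpose_mulVec A v v
  rw [hA, neg_mulVec, dotProduct_neg] at h
  linarith

/-- Pointwise power balance: the derivative of the Hamiltonian plus the dissipated power equals
the supplied power. -/
theorem power_balance {n m : Type*} [Fintype n] [Fintype m]
    {E Q J R K : Matrix n n ℝ} {B P : Matrix n m ℝ} {S N : Matrix m m ℝ}
    {x x' : n → ℝ} {u : m → ℝ} (hN : Nᵀ = -N) (hsym : Qᵀ * E = Eᵀ * Q)
    (hode : E *ᵥ x' = ((J - R) * Q - E * K) *ᵥ x + (B - P) *ᵥ u) :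
    (1 / 2 : ℝ) * (x' ⬝ᵥ (Qᵀ * E) *ᵥ x +
        x ⬝ᵥ ((Qᵀ * (E * K - J * Q) + (E * K - J * Q)ᵀ * Q) *ᵥ x + (Qᵀ * E) *ᵥ x')) +
      (x ⬝ᵥ (Qᵀ * R * Q) *ᵥ x + 2 * (x ⬝ᵥ (Qᵀ * P) *ᵥ u) + u ⬝ᵥ S *ᵥ u) =
      u ⬝ᵥ (((B + P)ᵀ * Q) *ᵥ x + (S + N) *ᵥ u) := by
  have h1 : x' ⬝ᵥ (Qᵀ * E) *ᵥ x = x ⬝ᵥ (Qᵀ * E) *ᵥ x' := by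
    rw [← dotProduct_transpose_mulVec, transpose_mul, transpose_transpose, hsym]
  have h2 : x ⬝ᵥ ((E * K - J * Q)ᵀ * Q) *ᵥ x = x ⬝ᵥ (Qᵀ * (E * K - J * Q)) *ᵥ x := by
    rw [← dotProduct_transpose_mulVec, transpose_mul, transpose_transpose]
  have h3 : u ⬝ᵥ ((B + P)ᵀ * Q) *ᵥ x = x ⬝ᵥ (Qᵀ * (B + P)) *ᵥ u := by
    rw [← dotProduct_transpose_mulVec, transpose_mul, transpose_transpose]
  have h4 : (Qᵀ * E) *ᵥ x' = (Qᵀ * ((J - R) * Q - E * K)) *ᵥ x + (Qᵀ * (B - P)) *ᵥ u := by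
    rw [← mulVec_mulVec, hode, mulVec_add, mulVec_mulVec, mulVec_mulVec]
  have h5 := dotProduct_mulVec_self_eq_zero hN u
  rw [dotProduct_add, dotProduct_add u, add_mulVec, dotProduct_add, h1, h2, h3, h4,
    add_mulVec, dotProduct_add, dotProduct_add, h5]
  simp only [Matrix.mul_add, Matrix.mul_sub, Matrix.sub_mul, Matrix.mul_assoc, add_mulVec,
    sub_mulVec, dotProduct_add, dotProduct_sub]
  ring

/-- Power balance for a linear time-varying port-Hamiltonian descriptor system:
if the dissipation matrix is positive semidefinite, the dissipation inequality holds. -/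
theorem pHDAE_dissipation_inequality
    (n m : ℕ) (t0 tf : ℝ) (htf : t0 ≤ tf)
    (E Q J R K : ℝ → Matrix (Fin n) (Fin n) ℝ)
    (B P : ℝ → Matrix (Fin n) (Fin m) ℝ)
    (S N : ℝ → Matrix (Fin m) (Fin m) ℝ)
    (hEc : ContinuousOn E (Set.Icc t0 tf)) (hQc : ContinuousOn Q (Set.Icc t0 tf))
    (hJc : ContinuousOn J (Set.Icc t0 tf)) (hRc : ContinuousOn R (Set.Icc t0 tf))
    (hKc : ContinuousOn K (Set.Icc t0 tf)) (hBc : ContinuousOn B (Set.Icc t0 tf))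
    (hPc : ContinuousOn P (Set.Icc t0 tf)) (hSc : ContinuousOn S (Set.Icc t0 tf))
    (hNc : ContinuousOn N (Set.Icc t0 tf))
    (hSsym : ∀ t ∈ Set.Icc t0 tf, (S t)ᵀ = S t)
    (hNskew : ∀ t ∈ Set.Icc t0 tf, (N t)ᵀ = -N t)
    (hsym : ∀ t ∈ Set.Icc t0 tf, (Q t)ᵀ * E t = (E t)ᵀ * Q t)
    (hQE : ∀ t ∈ Set.Icc t0 tf,
      MatHasDerivAt (fun s => (Q s)ᵀ * E s)
        (fun s => (Q s)ᵀ * (E s * K s - J s * Q s) +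
          (E s * K s - J s * Q s)ᵀ * Q s) t)
    (u : ℝ → Fin m → ℝ) (huc : ContinuousOn u (Set.Icc t0 tf))
    (x x' : ℝ → Fin n → ℝ)
    (hx : ∀ t ∈ Set.Icc t0 tf, HasDerivAt x (x' t) t)
    (hx'c : ContinuousOn x' (Set.Icc t0 tf))
    (hode : ∀ t ∈ Set.Icc t0 tf, E t *ᵥ x' t =
      ((J t - R t) * Q t - E t * K t) *ᵥ x t + (B t - P t) *ᵥ u t)
    (y : ℝ → Fin m → ℝ)
    (hy : ∀ t ∈ Set.Icc t0 tf,
      y t = ((B t + P t)ᵀ * Q t) *ᵥ x t + (S t + N t) *ᵥ u t)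
    (hW : ∀ t ∈ Set.Icc t0 tf, ∀ (z : Fin n → ℝ) (w : Fin m → ℝ),
      0 ≤ z ⬝ᵥ ((Q t)ᵀ * R t * Q t) *ᵥ z +
        2 * (z ⬝ᵥ ((Q t)ᵀ * P t) *ᵥ w) + w ⬝ᵥ S t *ᵥ w) :
    ∀ s t : ℝ, t0 ≤ s → s ≤ t → t ≤ tf →
      (1 / 2 : ℝ) * (x t ⬝ᵥ ((Q t)ᵀ * E t) *ᵥ x t) -
        (1 / 2 : ℝ) * (x s ⬝ᵥ ((Q s)ᵀ * E s) *ᵥ x s) ≤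
        ∫ τ in s..t, u τ ⬝ᵥ y τ := by
  intro s t hs hst ht
  have hsub : Icc s t ⊆ Icc t0 tf := Icc_subset_Icc hs ht
  have hxc : ContinuousOn x (Icc t0 tf) := fun τ hτ => (hx τ hτ).continuousAt.continuousWithinAt
  have hderiv : ∀ τ ∈ Icc t0 tf, HasDerivAt
      (fun σ => (1 / 2 : ℝ) * (x σ ⬝ᵥ ((Q σ)ᵀ * E σ) *ᵥ x σ)) _ τ := fun τ hτ =>
    ((hQE τ hτ).hasDerivAt_dotProduct_mulVec (hx τ hτ)).const_mul (1 / 2 : ℝ)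
  have hpower : ContinuousOn (fun τ => u τ ⬝ᵥ y τ) (Icc t0 tf) := by
    refine ContinuousOn.congr (f := fun τ =>
      u τ ⬝ᵥ (((B τ + P τ)ᵀ * Q τ) *ᵥ x τ + (S τ + N τ) *ᵥ u τ)) ?_
      fun τ hτ => by simp only [hy τ hτ]
    rw [continuousOn_iff_continuous_domRestrict] at *
    exact huc.dotProduct (((((hBc.add hPc).matrix_transpose).matrix_mul hQc).matrix_mulVec hxc).add
      ((hSc.add hNc).matrix_mulVec huc))
  refine intervalIntegral.sub_le_integral_of_hasDeriv_right_of_le hst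
    (fun τ hτ => (hderiv τ (hsub hτ)).continuousAt.continuousWithinAt)
    (fun τ hτ => (hderiv τ (hsub (Ioo_subset_Icc_self hτ))).hasDerivWithinAt)
    (hpower.mono hsub).integrableOn_Icc fun τ hτ => ?_
  have hτ' := hsub (Ioo_subset_Icc_self hτ)
  rw [hy τ hτ', ← power_balance (hNskew τ hτ') (hsym τ hτ') (hode τ hτ')]
  linarith [hW τ hτ' (x τ) (u τ)]
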